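/- Let D ⊆ ℝⁿ be open, let H : D × ℝⁿ → ℝ be continuous and satisfy (H1)–(H3), and let ℓ(x,y) := sup{⟨y,θ⟩ : θ ∈ ℝⁿ, H(x,θ) ≤ 0} be the induced local action. Then for every x ∈ D the following are equivalent: (a) ℓ(x,y) = 0 for all y ∈ ℝⁿ; (b) H_θ(x,0) = 0 and H(x,0) = 0. -/

import Mathlib

open MeasureTheory Set Filter
open scoped RealInnerProductSpace

abbrev Euc (n : ℕ) := EuclideanSpace ℝ (Fin n)

section StrongConvexity

variable {E : Type*} [NormedAddCommGroup E] [InnerProductSpace ℝ E] [CompleteSpace E]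
  {f : E → ℝ} {g : E → E} {A : E → E →L[ℝ] E} {m : ℝ}

/-- Quadratic lower bound at the origin for a function whose Hessian is bounded below by `m`. -/
lemma quadratic_lower_bound_of_hessian_bound
    (hf : ∀ θ, HasGradientAt f (g θ) θ) (hg : ∀ θ, HasFDerivAt g (A θ) θ)
    (hA : ∀ θ ξ, m * ‖ξ‖ ^ 2 ≤ ⟪ξ, A θ ξ⟫) (θ : E) :
    f 0 + ⟪g 0, θ⟫ + m / 2 * ‖θ‖ ^ 2 ≤ f θ := by
  have hline (t : ℝ) : HasDerivAt (fun s : ℝ => s • θ) θ t := by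
    simpa using (hasDerivAt_id t).smul_const θ
  have hslope (t : ℝ) : HasDerivAt (fun s : ℝ => ⟪g (s • θ), θ⟫ - m * ‖θ‖ ^ 2 * s)
      (⟪A (t • θ) θ, θ⟫ - m * ‖θ‖ ^ 2) t := by
    have h1 := ((hg (t • θ)).comp_hasDerivAt t (hline t)).inner ℝ (hasDerivAt_const t θ)
    have h2 := (hasDerivAt_id t).const_mul (m * ‖θ‖ ^ 2)
    exact (h1.sub h2).congr_deriv (by simp)
  have hmono : Monotone (fun s : ℝ => ⟪g (s • θ), θ⟫ - m * ‖θ‖ ^ 2 * s) := by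
    refine monotone_of_hasDerivAt_nonneg hslope fun t => ?_
    have := hA (t • θ) θ
    rw [real_inner_comm] at this
    simpa using this
  have hvalue (t : ℝ) :
      HasDerivAt (fun s : ℝ => f (s • θ) - ⟪g 0, θ⟫ * s - m / 2 * ‖θ‖ ^ 2 * s ^ 2)
        (⟪g (t • θ), θ⟫ - ⟪g 0, θ⟫ - m * ‖θ‖ ^ 2 * t) t := by
    have h1 := (hf (t • θ)).hasFDerivAt.comp_hasDerivAt t (hline t)
    have h2 := (hasDerivAt_id t).const_mul ⟪g 0, θ⟫
    have h3 := (hasDerivAt_pow 2 t).const_mul (m / 2 * ‖θ‖ ^ 2)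
    refine ((h1.sub h2).sub h3).congr_deriv ?_
    simp
    ring
  have hmono' : MonotoneOn (fun s : ℝ => f (s • θ) - ⟪g 0, θ⟫ * s - m / 2 * ‖θ‖ ^ 2 * s ^ 2)
      (Icc 0 1) := by
    refine monotoneOn_of_hasDerivWithinAt_nonneg (convex_Icc 0 1)
      (fun t _ => (hvalue t).continuousAt.continuousWithinAt)
      (fun t _ => (hvalue t).hasDerivWithinAt) fun t ht => ?_
    rw [interior_Icc] at ht
    have := hmono ht.1.le
    simp only [zero_smul, mul_zero, sub_zero] at this
    linarith
  have := hmono' (left_mem_Icc.2 zero_le_one) (right_mem_Icc.2 zero_le_one) zero_le_one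
  simp only [zero_smul, one_smul] at this
  linarith

/-- The nonpositive sublevel set is bounded if the Hessian is bounded below by `m > 0`. -/
lemma exists_norm_le_of_hessian_bound (hm : 0 < m)
    (hf : ∀ θ, HasGradientAt f (g θ) θ) (hg : ∀ θ, HasFDerivAt g (A θ) θ)
    (hA : ∀ θ ξ, m * ‖ξ‖ ^ 2 ≤ ⟪ξ, A θ ξ⟫) :
    ∃ R, ∀ θ, f θ ≤ 0 → ‖θ‖ ≤ R := by
  refine ⟨max 1 ((|f 0| + ‖g 0‖) / (m / 2)), fun θ hθ => ?_⟩
  rcases le_total ‖θ‖ 1 with h | h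
  · exact h.trans (le_max_left _ _)
  refine le_trans ?_ (le_max_right _ _)
  rw [le_div_iff₀ (by positivity)]
  have h1 := quadratic_lower_bound_of_hessian_bound hf hg hA θ
  have h2 := (abs_le.1 (abs_real_inner_le_norm (g 0) θ)).1
  have h3 : |f 0| ≤ |f 0| * ‖θ‖ := le_mul_of_one_le_right (abs_nonneg _) h
  have h4 := neg_abs_le (f 0)
  refine le_of_mul_le_mul_right (a := ‖θ‖) ?_ (by linarith)
  nlinarith

/-- The support function of the sublevel set `{f ≤ 0}` vanishes identically if and only if the
origin is a critical zero of the strongly convex function `f`. -/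
lemma support_function_eq_zero_iff [Nontrivial E] (hm : 0 < m) (h0 : f 0 ≤ 0)
    (hf : ∀ θ, HasGradientAt f (g θ) θ) (hg : ∀ θ, HasFDerivAt g (A θ) θ)
    (hA : ∀ θ ξ, m * ‖ξ‖ ^ 2 ≤ ⟪ξ, A θ ξ⟫) :
    (∀ y : E, sSup ((fun θ => ⟪y, θ⟫) '' {θ | f θ ≤ 0}) = 0) ↔ g 0 = 0 ∧ f 0 = 0 := by
  constructor
  · intro h
    obtain ⟨R, hR⟩ := exists_norm_le_of_hessian_bound hm hf hg hA
    have hpos (θ : E) (hθ : θ ≠ 0) : 0 < f θ := by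
      by_contra! hle
      have hbdd : BddAbove ((fun η => ⟪θ, η⟫) '' {η | f η ≤ 0}) := by
        refine ⟨‖θ‖ * R, ?_⟩
        rintro _ ⟨η, hη, rfl⟩
        exact (real_inner_le_norm θ η).trans (by gcongr; exact hR η hη)
      have hle' : ⟪θ, θ⟫ ≤ 0 := (h θ).subst (le_csSup hbdd ⟨θ, hle, rfl⟩)
      exact hθ (inner_self_eq_zero.1 (hle'.antisymm real_inner_self_nonneg))
    have hzero : f 0 = 0 := by
      have : (nhdsWithin (0 : E) {0}ᶜ).NeBot := Module.punctured_nhds_neBot ℝ E 0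
      refine le_antisymm h0 (ge_of_tendsto
        ((hf 0).continuousAt.tendsto.mono_left (nhdsWithin_le_nhds (s := {0}ᶜ))) ?_)
      filter_upwards [self_mem_nhdsWithin] with θ hθ using (hpos θ hθ).le
    have hmin : IsLocalMin f 0 := Eventually.of_forall fun θ => by
      rcases eq_or_ne θ 0 with rfl | hθ
      · exact le_rfl
      · exact hzero.trans_le (hpos θ hθ).le
    exact ⟨by simpa using hmin.hasFDerivAt_eq_zero (hf 0).hasFDerivAt, hzero⟩
  · rintro ⟨hg0, hf0⟩ y
    have hset : {θ | f θ ≤ 0} = {0} := by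
      ext θ
      refine ⟨fun hθ => ?_, fun hθ => by rw [mem_singleton_iff.1 hθ]; exact h0⟩
      have h1 := quadratic_lower_bound_of_hessian_bound hf hg hA θ
      rw [hg0, hf0, inner_zero_left] at h1
      have h2 : f θ ≤ 0 := hθ
      by_contra hne
      have : 0 < ‖θ‖ := norm_pos_iff.2 hne
      have : 0 < m / 2 * ‖θ‖ ^ 2 := by positivity
      linarith
    simp [hset]

end StrongConvexity

/-- for a Hamiltonian geometric action, a point `x` is critical
(i.e. `ℓ(x,·) ≡ 0`) if and only if `H_θ(x,0) = 0` and `H(x,0) = 0`. -/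
theorem statement2 {n : ℕ} (hn : 0 < n)
    (D : Set (Euc n)) (hD : IsOpen D) (hDne : D.Nonempty)
    (H : Euc n → Euc n → ℝ)
    (Hθ : Euc n → Euc n → Euc n)
    (Hθθ : Euc n → Euc n → (Euc n →L[ℝ] Euc n))
    (hHcont : ContinuousOn (fun p : Euc n × Euc n => H p.1 p.2) (D ×ˢ Set.univ))
    (hH1 : ∀ x ∈ D, H x 0 ≤ 0)
    (hHθ : ∀ x ∈ D, ∀ θ : Euc n, HasGradientAt (H x) (Hθ x θ) θ)
    (hHθθ : ∀ x ∈ D, ∀ θ : Euc n, HasFDerivAt (Hθ x) (Hθθ x θ) θ)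
    (hHθcont : ContinuousOn (fun p : Euc n × Euc n => Hθ p.1 p.2) (D ×ˢ Set.univ))
    (hHθθcont : ContinuousOn (fun p : Euc n × Euc n => Hθθ p.1 p.2) (D ×ˢ Set.univ))
    (hH3 : ∀ K ⊆ D, IsCompact K → ∃ m > (0:ℝ), ∀ x ∈ K, ∀ θ ξ : Euc n,
      m * ‖ξ‖ ^ 2 ≤ ⟪ξ, Hθθ x θ ξ⟫)
    (ℓ : Euc n → Euc n → ℝ)
    (hℓdef : ∀ x y : Euc n, ℓ x y = sSup ((fun θ => ⟪y, θ⟫) '' {θ | H x θ ≤ 0})) :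
    ∀ x ∈ D, ((∀ y : Euc n, ℓ x y = 0) ↔ (Hθ x 0 = 0 ∧ H x 0 = 0)) := by
  intro x hx
  have : Nonempty (Fin n) := ⟨⟨0, hn⟩⟩
  obtain ⟨m, hm, hA⟩ := hH3 {x} (singleton_subset_iff.2 hx) isCompact_singleton
  simp only [hℓdef]
  exact support_function_eq_zero_iff hm (hH1 x hx) (hHθ x hx) (hHθθ x hx) (hA x rfl)
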